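/- arXiv:1310.0121 — 8 statements merged into one kernel-verified Lean document; each statement's English description precedes it below -/
import Mathlib

section
/- Let n > 2. A group homomorphism φ : Dc_n → Dc_n is an automorphism if and only if there exist a unit r of Z/2n and an element s ∈ Z/2n such that φ(x) = x^r and φ(y) = y x^s. -/
open QuaternionGroup in
lemma dicyclic_map_a {n : ℕ} (hn : 2 < n) (φ : QuaternionGroup n →* QuaternionGroup n)
    (r : ZMod (2 * n)) (h : φ (a 1) = a r) (i : ZMod (2 * n)) : φ (a i) = a (i * r) := by
  have : NeZero n := ⟨by omega⟩
  have key : ∀ k : ℕ, φ (a (k : ZMod (2 * n))) = a ((k : ZMod (2 * n)) * r) := by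
    intro k
    induction k with
    | zero => simp
    | succ k ih =>
      have : (a ((k + 1 : ℕ) : ZMod (2 * n)) : QuaternionGroup n) = a (k : ZMod (2 * n)) * a 1 := by
        simp
      rw [this, map_mul, ih, h, a_mul_a]
      congr 1
      push_cast
      ring
  have := key i.val
  rwa [ZMod.natCast_zmod_val] at this

open QuaternionGroup in
lemma dicyclic_map_xa {n : ℕ} (hn : 2 < n) (φ : QuaternionGroup n →* QuaternionGroup n)
    (r : ZMod (2 * n)) (h : φ (a 1) = a r) (i : ZMod (2 * n)) :
    φ (xa i) = φ (xa 0) * a (i * r) := by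
  rw [← dicyclic_map_a hn φ r h, ← map_mul, xa_mul_a, zero_add]

/-- For `n > 2`, a group homomorphism `φ : Dc_n → Dc_n` is an automorphism (i.e. bijective)
if and only if there exist a unit `r` of `ℤ/2n` and `s ∈ ℤ/2n` with `φ(x) = x^r` and
`φ(y) = y * x^s`. Here `x^r = QuaternionGroup.a r` and `y = QuaternionGroup.xa 0`. -/
theorem dicyclic_hom_is_aut_iff (n : ℕ) (hn : 2 < n)
    (φ : QuaternionGroup n →* QuaternionGroup n) :
    Function.Bijective φ ↔
      ∃ (r : (ZMod (2 * n))ˣ) (s : ZMod (2 * n)),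
        φ (QuaternionGroup.a 1) = QuaternionGroup.a (r : ZMod (2 * n)) ∧
        φ (QuaternionGroup.xa 0) = QuaternionGroup.xa 0 * QuaternionGroup.a s := by
  have : NeZero n := ⟨by omega⟩
  constructor
  · intro hb
    have ho := orderOf_injective φ hb.1 (QuaternionGroup.a 1)
    rcases h1 : φ (QuaternionGroup.a 1) with r | r
    · have ha := dicyclic_map_a hn φ r h1
      have hx := dicyclic_map_xa hn φ r h1
      rcases h2 : φ (QuaternionGroup.xa 0) with s | s
      · exfalso
        obtain ⟨g | g, hg⟩ := hb.2 (QuaternionGroup.xa 0)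
        · rw [ha] at hg
          cases hg
        · rw [hx, h2, QuaternionGroup.a_mul_a] at hg
          cases hg
      · obtain ⟨g | g, hg⟩ := hb.2 (QuaternionGroup.a 1)
        · rw [ha] at hg
          have hg' := QuaternionGroup.a.inj hg
          exact ⟨⟨r, g, (mul_comm r g).trans hg', hg'⟩, s, rfl, by simp⟩
        · rw [hx, h2, QuaternionGroup.xa_mul_a] at hg
          cases hg
    · rw [h1, QuaternionGroup.orderOf_xa, QuaternionGroup.orderOf_a_one] at ho
      omega
  · rintro ⟨r, s, h1, h2⟩
    have ha := dicyclic_map_a hn φ r h1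
    have hx := dicyclic_map_xa hn φ r h1
    apply Function.Surjective.bijective_of_finite
    rintro (j | j)
    · exact ⟨QuaternionGroup.a (j * ↑r⁻¹), by rw [ha]; simp⟩
    · exact ⟨QuaternionGroup.xa ((j - s) * ↑r⁻¹), by rw [hx, h2]; simp⟩
end

section
/- Let n > 2. The automorphism φ_{(r,s)} of Dc_n is an inner automorphism if and only if s is even and either r ≡ 1 (mod 2n) or r ≡ 2n−1 (mod 2n). -/
/-- For `n > 2`, the automorphism `φ_(r,s)` of the dicyclic group `Dc_n` (determined by
`φ(x) = x^r`, `φ(y) = y * x^s`) is inner if and only if `s` is even and `r ≡ 1` or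
`r ≡ 2n - 1 (mod 2n)`. -/
theorem dicyclic_aut_inner_iff (n : ℕ) (hn : 2 < n) (r : (ZMod (2 * n))ˣ) (s : ZMod (2 * n))
    (φ : MulAut (QuaternionGroup n))
    (hx : φ (QuaternionGroup.a 1) = QuaternionGroup.a (r : ZMod (2 * n)))
    (hy : φ (QuaternionGroup.xa 0) = QuaternionGroup.xa 0 * QuaternionGroup.a s) :
    (∃ g : QuaternionGroup n, ∀ z, φ z = g * z * g⁻¹) ↔
      (Even s ∧ ((r : ZMod (2 * n)) = 1 ∨ (r : ZMod (2 * n)) = 2 * n - 1)) := by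
  have h2n : (2 * n : ZMod (2 * n)) = 0 := by norm_cast; simp
  have : NeZero (2 * n) := ⟨by omega⟩
  have ha : ∀ k : ZMod (2 * n), φ (QuaternionGroup.a k) = QuaternionGroup.a (k * (r : ZMod (2 * n))) := by
    intro k
    obtain ⟨m, rfl⟩ := ZMod.natCast_zmod_surjective k
    induction m with
    | zero => simp
    | succ m ih =>
      have : (QuaternionGroup.a ((m + 1 : ℕ) : ZMod (2 * n)) : QuaternionGroup n)
          = QuaternionGroup.a (m : ZMod (2 * n)) * QuaternionGroup.a 1 := by simp
      rw [this, map_mul, ih, hx, QuaternionGroup.a_mul_a]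
      congr 1
      push_cast
      ring
  have hxa : ∀ k : ZMod (2 * n), φ (QuaternionGroup.xa k) = QuaternionGroup.xa (s + k * (r : ZMod (2 * n))) := by
    intro k
    have : (QuaternionGroup.xa k : QuaternionGroup n)
        = QuaternionGroup.xa 0 * QuaternionGroup.a k := by simp
    rw [this, map_mul, hy, ha]
    simp
  simp only [eq_mul_inv_iff_mul_eq, h2n]
  constructor
  · rintro ⟨i | i, hg⟩
    · have h1 := hg (QuaternionGroup.a 1)
      have h0 := hg (QuaternionGroup.xa 0)
      rw [ha] at h1
      rw [hxa] at h0
      simp only [QuaternionGroup.a_mul_a, QuaternionGroup.xa_mul_a, QuaternionGroup.a_mul_xa,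
        QuaternionGroup.a.injEq, QuaternionGroup.xa.injEq] at h1 h0
      exact ⟨⟨-i, by linear_combination h0⟩, Or.inl (by linear_combination h1)⟩
    · have h1 := hg (QuaternionGroup.a 1)
      have h0 := hg (QuaternionGroup.xa 0)
      rw [ha] at h1
      rw [hxa] at h0
      simp only [QuaternionGroup.a_mul_xa, QuaternionGroup.xa_mul_a, QuaternionGroup.xa_mul_xa,
        QuaternionGroup.a.injEq, QuaternionGroup.xa.injEq] at h1 h0
      exact ⟨⟨i, by linear_combination -h0⟩, Or.inr (by linear_combination -h1)⟩
  · rintro ⟨⟨i, rfl⟩, hr | hr⟩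
    · refine ⟨QuaternionGroup.a (-i), ?_⟩
      rintro (k | k)
      · rw [ha, hr]
        simp [add_comm]
      · rw [hxa, hr]
        simp only [QuaternionGroup.xa_mul_a, QuaternionGroup.a_mul_xa, QuaternionGroup.xa.injEq]
        ring
    · refine ⟨QuaternionGroup.xa i, ?_⟩
      rintro (k | k)
      · rw [ha, hr]
        simp only [QuaternionGroup.xa_mul_a, QuaternionGroup.a_mul_xa, QuaternionGroup.xa.injEq]
        ring
      · rw [hxa, hr]
        simp only [QuaternionGroup.xa_mul_xa, QuaternionGroup.a.injEq]
        ring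
end

section
/- Let n > 2. Two automorphisms φ_{(r,s)} and φ_{(p,q)} of Dc_n are isomorphic (i.e., there exists σ ∈ Aut(Dc_n) with σ ∘ φ_{(p,q)} = φ_{(r,s)} ∘ σ) if and only if r = p and there exist a unit u of Z/2n and v ∈ Z/2n such that q·u − s ≡ v·(r − 1) (mod 2n). -/
open QuaternionGroup in
theorem dc_map_a (n : ℕ) (hn : 2 < n) (ψ : MulAut (QuaternionGroup n)) (t : ZMod (2 * n))
    (h : ψ (a 1) = a t) (i : ZMod (2 * n)) : ψ (a i) = a (t * i) := by
  have : NeZero (2 * n) := ⟨by omega⟩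
  have key : ∀ k : ℕ, ψ (a (k : ZMod (2 * n))) = a (t * (k : ZMod (2 * n))) := by
    intro k
    induction k with
    | zero =>
      rw [Nat.cast_zero, mul_zero, a_zero, map_one]
    | succ k ih =>
      rw [Nat.cast_succ, ← a_mul_a, map_mul, ih, h, a_mul_a, mul_add, mul_one]
  have := key i.val
  rwa [ZMod.natCast_zmod_val] at this

open QuaternionGroup in
theorem dc_exists_a (n : ℕ) (hn : 2 < n) (ψ : MulAut (QuaternionGroup n)) :
    ∃ t, ψ (a 1) = a t := by
  rcases h : ψ (a 1) with t | t
  · exact ⟨t, rfl⟩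
  · exfalso
    have h4 : ψ ((a 1) ^ 4) = ψ 1 := by rw [map_pow, h, xa_pow_four, map_one]
    have h5 := ψ.injective h4
    rw [a_one_pow, one_def] at h5
    have h6 : ((4 : ℕ) : ZMod (2 * n)) = 0 := by injection h5
    rw [ZMod.natCast_eq_zero_iff] at h6
    have := Nat.le_of_dvd (by norm_num) h6
    omega

theorem dc_unit_mul (n : ℕ) (hn : 2 < n) (u : (ZMod (2 * n))ˣ) :
    (u : ZMod (2 * n)) * (n : ZMod (2 * n)) = n := by
  have : NeZero (2 * n) := ⟨by omega⟩
  have hc : Nat.Coprime (u : ZMod (2 * n)).val (2 * n) := ZMod.val_coe_unit_coprime u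
  have ho : Odd (u : ZMod (2 * n)).val :=
    Nat.coprime_two_right.mp (Nat.Coprime.coprime_dvd_right ⟨n, rfl⟩ hc)
  obtain ⟨k, hk⟩ := ho
  have h0 : ((2 * n : ℕ) : ZMod (2 * n)) = 0 := ZMod.natCast_self _
  push_cast at h0
  rw [← ZMod.natCast_zmod_val (u : ZMod (2 * n)), hk]
  push_cast
  linear_combination (k : ZMod (2 * n)) * h0

open QuaternionGroup in
/-- The automorphism `φ_(u,v)`. -/
def dcAut (n : ℕ) (hn : 2 < n) (u : (ZMod (2 * n))ˣ) (v : ZMod (2 * n)) :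
    MulAut (QuaternionGroup n) where
  toFun
    | a i => a (u * i)
    | xa i => xa (v + u * i)
  invFun
    | a i => a ((u⁻¹ : (ZMod (2 * n))ˣ) * i)
    | xa i => xa ((u⁻¹ : (ZMod (2 * n))ˣ) * (i - v))
  left_inv := by rintro (i | i) <;> simp
  right_inv := by rintro (i | i) <;> simp
  map_mul' := by
    have h := dc_unit_mul n hn u
    rintro (i | i) (j | j)
    · simp only [a_mul_a]; congr 1; ring
    · simp only [a_mul_xa]; congr 1; ring
    · simp only [xa_mul_a]; congr 1; ring
    · simp only [xa_mul_xa]; congr 1; linear_combination h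

/-- For `n > 2`, two automorphisms `φ = φ_(r,s)` and `ϑ = φ_(p,q)` of the dicyclic group
`Dc_n` are isomorphic (i.e. `σ ∘ ϑ = φ ∘ σ` for some automorphism `σ`) if and only if
`r = p` and `q·u - s ≡ v·(r - 1) (mod 2n)` for some unit `u` of `ℤ/2n` and some
`v ∈ ℤ/2n`. -/
theorem dicyclic_aut_isomorphy (n : ℕ) (hn : 2 < n)
    (r p : (ZMod (2 * n))ˣ) (s q : ZMod (2 * n))
    (φ ϑ : MulAut (QuaternionGroup n))
    (hφx : φ (QuaternionGroup.a 1) = QuaternionGroup.a (r : ZMod (2 * n)))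
    (hφy : φ (QuaternionGroup.xa 0) = QuaternionGroup.xa 0 * QuaternionGroup.a s)
    (hϑx : ϑ (QuaternionGroup.a 1) = QuaternionGroup.a (p : ZMod (2 * n)))
    (hϑy : ϑ (QuaternionGroup.xa 0) = QuaternionGroup.xa 0 * QuaternionGroup.a q) :
    (∃ σ : MulAut (QuaternionGroup n), ∀ z, σ (ϑ z) = φ (σ z)) ↔
      ((r : ZMod (2 * n)) = (p : ZMod (2 * n)) ∧
        ∃ (u : (ZMod (2 * n))ˣ) (v : ZMod (2 * n)),
          q * (u : ZMod (2 * n)) - s = v * ((r : ZMod (2 * n)) - 1)) := by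
  have hφa := dc_map_a n hn φ r hφx
  have hϑa := dc_map_a n hn ϑ p hϑx
  have hφxa : ∀ i, φ (QuaternionGroup.xa i) = QuaternionGroup.xa (s + (r : ZMod (2 * n)) * i) := by
    intro i
    have : QuaternionGroup.xa i = QuaternionGroup.xa 0 * QuaternionGroup.a i := by simp
    rw [this, map_mul, hφy, hφa]; simp
  have hϑxa : ∀ i, ϑ (QuaternionGroup.xa i) = QuaternionGroup.xa (q + (p : ZMod (2 * n)) * i) := by
    intro i
    have : QuaternionGroup.xa i = QuaternionGroup.xa 0 * QuaternionGroup.a i := by simp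
    rw [this, map_mul, hϑy, hϑa]; simp
  constructor
  · rintro ⟨σ, hσ⟩
    obtain ⟨t, ht⟩ := dc_exists_a n hn σ
    obtain ⟨w, hw⟩ := dc_exists_a n hn σ⁻¹
    have hσa := dc_map_a n hn σ t ht
    have htw : t * w = 1 := by
      have h1 : σ (σ⁻¹ (QuaternionGroup.a 1)) = QuaternionGroup.a 1 := by simp
      rw [hw, hσa] at h1
      injection h1
    have hx := hσ (QuaternionGroup.a 1)
    rw [hϑa, hσa, hσa, hφa] at hx
    have hx' : t * (p * 1) = r * (t * 1) := by injection hx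
    have hrp : (r : ZMod (2 * n)) = p := by
      linear_combination (-w) * hx' + (p - r : ZMod (2 * n)) * htw
    refine ⟨hrp, ⟨t, w, htw, by linear_combination htw⟩, ?_⟩
    rcases hv : σ (QuaternionGroup.xa 0) with j | v
    · exfalso
      have h1 : σ (QuaternionGroup.a (w * j)) = σ (QuaternionGroup.xa 0) := by
        rw [hv, hσa, ← mul_assoc, htw, one_mul]
      have h2 := σ.injective h1
      cases h2
    · refine ⟨v, ?_⟩
      have hy := hσ (QuaternionGroup.xa 0)
      rw [hϑy, map_mul, hv, hσa, hφxa, QuaternionGroup.xa_mul_a] at hy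
      have hy' : v + t * q = s + r * v := by injection hy
      change q * t - s = v * (r - 1)
      linear_combination hy'
  · rintro ⟨hrp, u, v, huv⟩
    refine ⟨dcAut n hn u v, ?_⟩
    rintro (i | i)
    · rw [hϑa]
      change QuaternionGroup.a _ = φ (QuaternionGroup.a _)
      rw [hφa, hrp]; congr 1; ring
    · rw [hϑxa]
      change QuaternionGroup.xa _ = φ (QuaternionGroup.xa _)
      rw [hφxa]; congr 1
      linear_combination huv - (u : ZMod (2 * n)) * i * hrp
end

section
/- Let n > 2 and let φ = φ_{(r,s)} be an automorphism of Dc_n. Then the generalized symmetric space is Q = {x^{b(1−r)} : b ∈ Z/2n} ∪ {x^{s + b(r−1)} : b ∈ Z/2n}, and the fixed-point group is H = {x^b : b(1−r) ≡ 0 (mod 2n)} ∪ {y x^b : b(1−r) ≡ s (mod 2n)}. -/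
/-- For `n > 2`, let `φ = φ_(r,s)` be the automorphism of the dicyclic group `Dc_n` with
`φ(x) = x^r`, `φ(y) = y·x^s`. Then the generalized symmetric space is
`Q = {x^(b(1-r)) : b} ∪ {x^(s + b(r-1)) : b}` and the fixed-point group is
`H = {x^b : b(1-r) ≡ 0} ∪ {y·x^b : b(1-r) ≡ s}`. -/
theorem dicyclic_Q_and_H (n : ℕ) (hn : 2 < n) (r : (ZMod (2 * n))ˣ) (s : ZMod (2 * n))
    (φ : MulAut (QuaternionGroup n))
    (hx : φ (QuaternionGroup.a 1) = QuaternionGroup.a (r : ZMod (2 * n)))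
    (hy : φ (QuaternionGroup.xa 0) = QuaternionGroup.xa 0 * QuaternionGroup.a s) :
    ({z : QuaternionGroup n | ∃ g, z = g * (φ g)⁻¹} =
      {z : QuaternionGroup n | ∃ b : ZMod (2 * n),
          z = QuaternionGroup.a (b * (1 - (r : ZMod (2 * n))))} ∪
      {z : QuaternionGroup n | ∃ b : ZMod (2 * n),
          z = QuaternionGroup.a (s + b * ((r : ZMod (2 * n)) - 1))}) ∧
    ({g : QuaternionGroup n | φ g = g} =
      {z : QuaternionGroup n | ∃ b : ZMod (2 * n),
          z = QuaternionGroup.a b ∧ b * (1 - (r : ZMod (2 * n))) = 0} ∪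
      {z : QuaternionGroup n | ∃ b : ZMod (2 * n),
          z = QuaternionGroup.xa 0 * QuaternionGroup.a b ∧
            b * (1 - (r : ZMod (2 * n))) = s}) := by
  have hpow : ∀ (c : ZMod (2 * n)) (k : ℕ),
      (QuaternionGroup.a c : QuaternionGroup n) ^ k = QuaternionGroup.a ((k : ZMod (2 * n)) * c) := by
    intro c k
    induction k with
    | zero => simp
    | succ k ih =>
      rw [pow_succ, ih, QuaternionGroup.a_mul_a]
      congr 1
      push_cast
      ring
  have : NeZero (2 * n) := ⟨by omega⟩
  have ha : ∀ b : ZMod (2 * n), φ (QuaternionGroup.a b) = QuaternionGroup.a (b * (r : ZMod (2 * n))) := by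
    intro b
    have h1 : (QuaternionGroup.a b : QuaternionGroup n) = QuaternionGroup.a 1 ^ b.val := by
      rw [hpow, mul_one, ZMod.natCast_zmod_val]
    rw [h1, map_pow, hx, hpow, ZMod.natCast_zmod_val]
  have hxa : ∀ b : ZMod (2 * n), φ (QuaternionGroup.xa b) = QuaternionGroup.xa (s + b * (r : ZMod (2 * n))) := by
    intro b
    have h1 : (QuaternionGroup.xa b : QuaternionGroup n)
        = QuaternionGroup.xa 0 * QuaternionGroup.a b := by simp
    rw [h1, map_mul, hy, ha]
    simp
  have qa : ∀ b : ZMod (2 * n), QuaternionGroup.a b * (φ (QuaternionGroup.a b))⁻¹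
      = QuaternionGroup.a (b * (1 - (r : ZMod (2 * n)))) := by
    intro b
    rw [ha, mul_inv_eq_iff_eq_mul, QuaternionGroup.a_mul_a]
    congr 1
    ring
  have qx : ∀ b : ZMod (2 * n), QuaternionGroup.xa b * (φ (QuaternionGroup.xa b))⁻¹
      = QuaternionGroup.a (s + b * ((r : ZMod (2 * n)) - 1)) := by
    intro b
    rw [hxa, mul_inv_eq_iff_eq_mul, QuaternionGroup.a_mul_xa]
    congr 1
    ring
  constructor
  · ext z
    constructor
    · rintro ⟨b | b, rfl⟩
      · exact Or.inl ⟨b, qa b⟩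
      · exact Or.inr ⟨b, qx b⟩
    · rintro (⟨b, rfl⟩ | ⟨b, rfl⟩)
      · exact ⟨_, (qa b).symm⟩
      · exact ⟨_, (qx b).symm⟩
  · ext z
    constructor
    · intro h
      rcases z with b | b
      · refine Or.inl ⟨b, rfl, ?_⟩
        have h' : QuaternionGroup.a (b * (r : ZMod (2 * n))) = QuaternionGroup.a b := (ha b).symm.trans h
        have := QuaternionGroup.a.inj h'
        linear_combination -this
      · refine Or.inr ⟨b, by simp, ?_⟩
        have h' : QuaternionGroup.xa (s + b * (r : ZMod (2 * n))) = QuaternionGroup.xa b := (hxa b).symm.trans h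
        have := QuaternionGroup.xa.inj h'
        linear_combination -this
    · rintro (⟨b, rfl, h⟩ | ⟨b, rfl, h⟩)
      · refine (ha b).trans (congrArg _ ?_)
        linear_combination -h
      · rw [QuaternionGroup.xa_mul_a, zero_add]
        refine (hxa b).trans (congrArg _ ?_)
        linear_combination -h
end

section
/- Let n > 2 and let φ = φ_{(r,s)} be a non-trivial inner automorphism of Dc_n (so s is even and r = 1 or r = 2n−1). If r = 1, then Q = {1, x^s} and H = ⟨x⟩ = {1, x, x², …, x^{2n−1}}. If r = 2n−1, then Q = {1, x², …, x^{2n−2}} (the even powers of x) and H = {1, x^n, y x^{s/2}, y x^{s/2 + n}}. -/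
theorem dic_two_n (n : ℕ) : (2 : ZMod (2 * n)) * (n : ZMod (2 * n)) = 0 := by
  have h := ZMod.natCast_self (2 * n)
  push_cast at h
  exact h

theorem dic_two_mul_eq_zero (n : ℕ) (hn : 2 < n) (b : ZMod (2 * n)) (h : 2 * b = 0) :
    b = 0 ∨ b = (n : ZMod (2 * n)) := by
  haveI : NeZero (2 * n) := ⟨by omega⟩
  have hb : ((b.val : ℕ) : ZMod (2 * n)) = b := ZMod.natCast_zmod_val b
  have hlt := ZMod.val_lt b
  have h2 : ((2 * b.val : ℕ) : ZMod (2 * n)) = 0 := by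
    push_cast
    rw [hb, h]
  rw [ZMod.natCast_eq_zero_iff] at h2
  have h3 : n ∣ b.val := Nat.dvd_of_mul_dvd_mul_left (by norm_num) h2
  obtain ⟨c, hc⟩ := h3
  have hc2 : c < 2 := by
    by_contra hcon
    have : n * 2 ≤ n * c := Nat.mul_le_mul_left n (by omega)
    omega
  interval_cases c
  · left
    rw [← hb, hc]
    simp
  · right
    rw [← hb, hc]
    simp

theorem dic_inv_a (n : ℕ) (i : ZMod (2 * n)) :
    (QuaternionGroup.a i)⁻¹ = QuaternionGroup.a (-i) := rfl

theorem dic_inv_xa (n : ℕ) (i : ZMod (2 * n)) :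
    (QuaternionGroup.xa i)⁻¹ = QuaternionGroup.xa ((n : ZMod (2 * n)) + i) := rfl

theorem dic_map_a (n : ℕ) (hn : 2 < n) (r : ZMod (2 * n)) (φ : MulAut (QuaternionGroup n))
    (hx : φ (QuaternionGroup.a 1) = QuaternionGroup.a r) (b : ZMod (2 * n)) :
    φ (QuaternionGroup.a b) = QuaternionGroup.a (r * b) := by
  haveI : NeZero (2 * n) := ⟨by omega⟩
  have key : ∀ k : ℕ, φ (QuaternionGroup.a (k : ZMod (2 * n))) =
      QuaternionGroup.a (r * (k : ZMod (2 * n))) := by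
    intro k
    induction k with
    | zero => simp
    | succ k ih =>
      have : (QuaternionGroup.a ((k + 1 : ℕ) : ZMod (2 * n))) =
          QuaternionGroup.a (k : ZMod (2 * n)) * QuaternionGroup.a 1 := by simp
      rw [this, map_mul, ih, hx, QuaternionGroup.a_mul_a]
      push_cast
      congr 1
      ring
  have := key b.val
  rwa [ZMod.natCast_zmod_val] at this

theorem dic_map_xa (n : ℕ) (hn : 2 < n) (r s : ZMod (2 * n)) (φ : MulAut (QuaternionGroup n))
    (hx : φ (QuaternionGroup.a 1) = QuaternionGroup.a r)
    (hy : φ (QuaternionGroup.xa 0) = QuaternionGroup.xa 0 * QuaternionGroup.a s)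
    (b : ZMod (2 * n)) :
    φ (QuaternionGroup.xa b) = QuaternionGroup.xa (s + r * b) := by
  have : (QuaternionGroup.xa b) = QuaternionGroup.xa 0 * QuaternionGroup.a b := by simp
  rw [this, map_mul, hy, dic_map_a n hn r φ hx]
  simp

theorem dic_even (n : ℕ) (s : ZMod (2 * n)) (φ : MulAut (QuaternionGroup n))
    (hy : φ (QuaternionGroup.xa 0) = QuaternionGroup.xa 0 * QuaternionGroup.a s)
    (hinner : ∃ g : QuaternionGroup n, ∀ z, φ z = g * z * g⁻¹) :
    ∃ t, s = 2 * t := by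
  have h2n := dic_two_n n
  obtain ⟨g, hg⟩ := hinner
  have h := hg (QuaternionGroup.xa 0)
  rw [hy] at h
  rcases g with i | i
  · simp only [dic_inv_a, QuaternionGroup.a_mul_xa, QuaternionGroup.xa_mul_a,
      QuaternionGroup.xa.injEq] at h
    exact ⟨-i, by linear_combination h⟩
  · simp only [dic_inv_xa, QuaternionGroup.a_mul_xa, QuaternionGroup.xa_mul_a,
      QuaternionGroup.xa_mul_xa, QuaternionGroup.xa.injEq] at h
    exact ⟨i, by linear_combination h⟩

/-- For `n > 2`, let `φ = φ_(r,s)` be a non-trivial inner automorphism of the dicyclic group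
`Dc_n` (with `φ(x) = x^r`, `φ(y) = y·x^s`). If `r = 1` then `Q = {1, x^s}` and
`H = ⟨x⟩ = {1, x, …, x^(2n-1)}`; if `r = 2n - 1` then `Q` consists of the even powers of `x`
and `H = {1, x^n, y·x^(s/2), y·x^(s/2+n)}`. -/
theorem dicyclic_inner_Q_and_H (n : ℕ) (hn : 2 < n) (r : (ZMod (2 * n))ˣ) (s : ZMod (2 * n))
    (φ : MulAut (QuaternionGroup n))
    (hx : φ (QuaternionGroup.a 1) = QuaternionGroup.a (r : ZMod (2 * n)))
    (hy : φ (QuaternionGroup.xa 0) = QuaternionGroup.xa 0 * QuaternionGroup.a s)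
    (hinner : ∃ g : QuaternionGroup n, ∀ z, φ z = g * z * g⁻¹)
    (hne : φ ≠ 1) :
    ((r : ZMod (2 * n)) = 1 →
      ({z : QuaternionGroup n | ∃ g, z = g * (φ g)⁻¹} =
        {1, QuaternionGroup.a s} ∧
       {g : QuaternionGroup n | φ g = g} =
        {z : QuaternionGroup n | ∃ b : ZMod (2 * n), z = QuaternionGroup.a b})) ∧
    ((r : ZMod (2 * n)) = 2 * n - 1 →
      ({z : QuaternionGroup n | ∃ g, z = g * (φ g)⁻¹} =
        {z : QuaternionGroup n | ∃ b : ZMod (2 * n), z = QuaternionGroup.a (2 * b)} ∧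
       ∀ t : ZMod (2 * n), s = 2 * t →
        {g : QuaternionGroup n | φ g = g} =
          {1, QuaternionGroup.a (n : ZMod (2 * n)),
            QuaternionGroup.xa 0 * QuaternionGroup.a t,
            QuaternionGroup.xa 0 * QuaternionGroup.a (t + (n : ZMod (2 * n)))})) := by
  have h2n := dic_two_n n
  have ha := dic_map_a n hn r φ hx
  have hxa := dic_map_xa n hn r s φ hx hy
  obtain ⟨u, hu⟩ := dic_even n s φ hy hinner
  refine ⟨fun hr => ?_, fun hr => ?_⟩
  · rw [hr] at ha hxa
    have hs : s ≠ 0 := by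
      rintro rfl
      apply hne
      ext g
      rcases g with b | b
      · simp [ha]
      · simp [hxa]
    refine ⟨?_, ?_⟩
    · ext z
      simp only [Set.mem_setOf_eq, Set.mem_insert_iff, Set.mem_singleton_iff]
      constructor
      · rintro ⟨g, rfl⟩
        rcases g with b | b
        · left
          rw [ha, one_mul, mul_inv_cancel]
        · right
          rw [hxa, dic_inv_xa, QuaternionGroup.xa_mul_xa]
          congr 1
          linear_combination h2n
      · rintro (rfl | rfl)
        · exact ⟨1, by simp⟩
        · refine ⟨QuaternionGroup.xa 0, ?_⟩
          rw [hxa, dic_inv_xa, QuaternionGroup.xa_mul_xa]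
          congr 1
          linear_combination -h2n
    · ext z
      simp only [Set.mem_setOf_eq]
      rcases z with b | b
      · simp [ha]
      · simp [hxa, hs]
  · have hr' : (r : ZMod (2 * n)) = -1 := by rw [hr, h2n, zero_sub]
    rw [hr'] at ha hxa
    refine ⟨?_, ?_⟩
    · ext z
      simp only [Set.mem_setOf_eq]
      constructor
      · rintro ⟨g, rfl⟩
        rcases g with b | b
        · refine ⟨b, ?_⟩
          rw [ha, dic_inv_a, QuaternionGroup.a_mul_a]
          congr 1
          ring
        · refine ⟨u - b, ?_⟩
          rw [hxa, dic_inv_xa, QuaternionGroup.xa_mul_xa]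
          congr 1
          linear_combination h2n + hu
      · rintro ⟨b, rfl⟩
        refine ⟨QuaternionGroup.a b, ?_⟩
        rw [ha, dic_inv_a, QuaternionGroup.a_mul_a]
        congr 1
        ring
    · intro t ht
      ext z
      simp only [Set.mem_setOf_eq, Set.mem_insert_iff, Set.mem_singleton_iff,
        QuaternionGroup.one_def, QuaternionGroup.xa_mul_a, zero_add]
      rcases z with b | b
      · simp only [ha, QuaternionGroup.a.injEq, reduceCtorEq, or_false]
        constructor
        · intro h
          exact dic_two_mul_eq_zero n hn b (by linear_combination -h)
        · rintro (rfl | rfl)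
          · ring
          · linear_combination -h2n
      · simp only [hxa, QuaternionGroup.xa.injEq, reduceCtorEq, false_or]
        constructor
        · intro h
          rcases dic_two_mul_eq_zero n hn (b - t) (by linear_combination -h + ht) with h | h
          · left
            linear_combination h
          · right
            linear_combination h
        · rintro (rfl | rfl)
          · linear_combination ht
          · linear_combination ht - h2n
end

section
/- Let n > 2 and let φ = φ_{(r,s)} be an automorphism of Dc_n. Then the set of elements split by φ is R = {x^b : b(r+1) ≡ 0 (mod 2n)} ∪ {y x^b : s + rb ≡ n + b (mod 2n)}. -/
/-- For `n > 2`, let `φ = φ_(r,s)` be the automorphism of the dicyclic group `Dc_n` with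
`φ(x) = x^r`, `φ(y) = y·x^s`. Then the set of elements split by `φ` is
`R = {x^b : b(r+1) ≡ 0} ∪ {y·x^b : s + r·b ≡ n + b}`. -/
theorem dicyclic_split_elements (n : ℕ) (hn : 2 < n) (r : (ZMod (2 * n))ˣ) (s : ZMod (2 * n))
    (φ : MulAut (QuaternionGroup n))
    (hx : φ (QuaternionGroup.a 1) = QuaternionGroup.a (r : ZMod (2 * n)))
    (hy : φ (QuaternionGroup.xa 0) = QuaternionGroup.xa 0 * QuaternionGroup.a s) :
    {g : QuaternionGroup n | φ g = g⁻¹} =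
      {z : QuaternionGroup n | ∃ b : ZMod (2 * n),
          z = QuaternionGroup.a b ∧ b * ((r : ZMod (2 * n)) + 1) = 0} ∪
      {z : QuaternionGroup n | ∃ b : ZMod (2 * n),
          z = QuaternionGroup.xa 0 * QuaternionGroup.a b ∧
            s + (r : ZMod (2 * n)) * b = (n : ZMod (2 * n)) + b} := by
  have : NeZero (2 * n) := ⟨by omega⟩
  have ha_pow : ∀ (c : ZMod (2 * n)) (k : ℕ),
      (QuaternionGroup.a c : QuaternionGroup n) ^ k = QuaternionGroup.a (c * (k : ZMod (2 * n))) := by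
    intro c k
    induction k with
    | zero => simp
    | succ k ih =>
      rw [pow_succ, ih, QuaternionGroup.a_mul_a]
      congr 1
      push_cast
      ring
  have ha : ∀ b : ZMod (2 * n),
      φ (QuaternionGroup.a b) = QuaternionGroup.a ((r : ZMod (2 * n)) * b) := by
    intro b
    have hb : (QuaternionGroup.a b : QuaternionGroup n) = QuaternionGroup.a 1 ^ b.val := by
      rw [ha_pow, ZMod.natCast_zmod_val, one_mul]
    rw [hb, map_pow, hx, ha_pow, ZMod.natCast_zmod_val]
  have hxa : ∀ b : ZMod (2 * n),
      φ (QuaternionGroup.xa b) = QuaternionGroup.xa (s + (r : ZMod (2 * n)) * b) := by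
    intro b
    have hb : (QuaternionGroup.xa b : QuaternionGroup n) =
        QuaternionGroup.xa 0 * QuaternionGroup.a b := by
      rw [QuaternionGroup.xa_mul_a, zero_add]
    rw [hb, map_mul, hy, ha, QuaternionGroup.xa_mul_a, QuaternionGroup.xa_mul_a, zero_add]
  ext g
  rcases g with b | b
  · simp only [Set.mem_ofPred_eq, Set.mem_union, eq_inv_iff_mul_eq_one, ha,
      QuaternionGroup.a_mul_a, QuaternionGroup.xa_mul_a, QuaternionGroup.one_def,
      QuaternionGroup.a.injEq, reduceCtorEq, false_and, exists_false, or_false,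
      exists_eq_left']
    rw [mul_add, mul_one, mul_comm b]
  · simp only [Set.mem_ofPred_eq, Set.mem_union, eq_inv_iff_mul_eq_one, hxa,
      QuaternionGroup.xa_mul_xa, QuaternionGroup.xa_mul_a, QuaternionGroup.one_def,
      QuaternionGroup.a.injEq, QuaternionGroup.xa.injEq, reduceCtorEq, false_and,
      exists_false, false_or, zero_add, exists_eq_left']
    rw [sub_eq_zero, eq_comm]
end

section
/- Let n > 2 and let φ = φ_{(r,s)} be an automorphism of Dc_n with fixed-point group H and generalized symmetric space Q, where H acts on Q by φ-twisted conjugation h * q = h q φ(h)⁻¹. If s does not lie in the subgroup ⟨1−r⟩ of Z/2n, then every H-orbit in Q is a singleton {x^j} for x^j ∈ Q. If s lies in ⟨1−r⟩, then the H-orbits in Q are exactly the sets {x^j, x^{−j}} for x^j ∈ Q. -/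
/-- For `n > 2`, let `φ = φ_(r,s)` be the automorphism of the dicyclic group `Dc_n` with
`φ(x) = x^r`, `φ(y) = y·x^s`, with fixed-point group `H = {h : φ h = h}` acting on the
generalized symmetric space `Q = {g·φ(g)⁻¹}` by twisted conjugation `h * q = h·q·φ(h)⁻¹`.
If `s ∉ ⟨1 - r⟩` (the additive subgroup of `ℤ/2n` generated by `1 - r`), then every
`H`-orbit in `Q` is a singleton; if `s ∈ ⟨1 - r⟩`, the `H`-orbit of `x^j ∈ Q` is
`{x^j, x^(-j)}`. -/
theorem dicyclic_H_orbits (n : ℕ) (hn : 2 < n) (r : (ZMod (2 * n))ˣ) (s : ZMod (2 * n))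
    (φ : MulAut (QuaternionGroup n))
    (hx : φ (QuaternionGroup.a 1) = QuaternionGroup.a (r : ZMod (2 * n)))
    (hy : φ (QuaternionGroup.xa 0) = QuaternionGroup.xa 0 * QuaternionGroup.a s) :
    (s ∉ AddSubgroup.zmultiples (1 - (r : ZMod (2 * n))) →
      ∀ q ∈ {z : QuaternionGroup n | ∃ g, z = g * (φ g)⁻¹},
        {z : QuaternionGroup n | ∃ h, φ h = h ∧ z = h * q * (φ h)⁻¹} = {q}) ∧
    (s ∈ AddSubgroup.zmultiples (1 - (r : ZMod (2 * n))) →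
      ∀ j : ZMod (2 * n),
        QuaternionGroup.a j ∈ {z : QuaternionGroup n | ∃ g, z = g * (φ g)⁻¹} →
        {z : QuaternionGroup n | ∃ h, φ h = h ∧ z = h * QuaternionGroup.a j * (φ h)⁻¹} =
          {QuaternionGroup.a j, QuaternionGroup.a (-j)}) := by
  have : NeZero (2 * n) := ⟨by omega⟩
  have ha : ∀ i : ZMod (2 * n), φ (QuaternionGroup.a i) = QuaternionGroup.a (i * (r : ZMod (2 * n))) := by
    intro i
    have h1 : (QuaternionGroup.a i : QuaternionGroup n) = QuaternionGroup.a 1 ^ i.val := by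
      rw [QuaternionGroup.a_one_pow, ZMod.natCast_zmod_val]
    have h2 : ∀ k : ℕ, (QuaternionGroup.a (r : ZMod (2 * n)) : QuaternionGroup n) ^ k
        = QuaternionGroup.a ((k : ZMod (2 * n)) * (r : ZMod (2 * n))) := by
      intro k
      induction k with
      | zero => simp
      | succ k ih =>
        rw [pow_succ, ih, QuaternionGroup.a_mul_a]
        congr 1
        push_cast
        ring
    rw [h1, map_pow, hx, h2, ZMod.natCast_zmod_val]
  have hxa : ∀ i : ZMod (2 * n), φ (QuaternionGroup.xa i) = QuaternionGroup.xa (s + i * (r : ZMod (2 * n))) := by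
    intro i
    have h1 : (QuaternionGroup.xa i : QuaternionGroup n)
        = QuaternionGroup.xa 0 * QuaternionGroup.a i := by simp
    rw [h1, map_mul, hy, ha]
    simp
  have hmem : ∀ i : ZMod (2 * n), φ (QuaternionGroup.xa i) = QuaternionGroup.xa i ↔
      s = i * (1 - r) := by
    intro i
    rw [hxa, QuaternionGroup.xa.injEq]
    constructor
    · intro h
      linear_combination h
    · intro h
      linear_combination h
  have hz : s ∈ AddSubgroup.zmultiples (1 - (r : ZMod (2 * n))) ↔
      ∃ i : ZMod (2 * n), s = i * (1 - r) := by
    rw [AddSubgroup.mem_zmultiples_iff]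
    constructor
    · rintro ⟨k, hk⟩
      exact ⟨k, by rw [← hk, zsmul_eq_mul]⟩
    · rintro ⟨i, hi⟩
      exact ⟨(i.val : ℤ), by rw [hi, zsmul_eq_mul]; simp⟩
  have hinv : ∀ i : ZMod (2 * n), (QuaternionGroup.a i : QuaternionGroup n)⁻¹
      = QuaternionGroup.a (-i) := fun _ => rfl
  have hcomm : ∀ i j : ZMod (2 * n), (QuaternionGroup.a i * QuaternionGroup.a j *
      (QuaternionGroup.a i)⁻¹ : QuaternionGroup n) = QuaternionGroup.a j := by
    intro i j
    rw [mul_inv_eq_iff_eq_mul]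
    simp [add_comm]
  have hconj : ∀ i j : ZMod (2 * n), (QuaternionGroup.xa i * QuaternionGroup.a j *
      (QuaternionGroup.xa i)⁻¹ : QuaternionGroup n) = QuaternionGroup.a (-j) := by
    intro i j
    rw [mul_inv_eq_iff_eq_mul]
    simp
  constructor
  · intro hs q hq
    obtain ⟨j, rfl⟩ : ∃ j, q = QuaternionGroup.a j := by
      obtain ⟨g, rfl⟩ := hq
      rcases g with i | i
      · exact ⟨i + -(i * (r : ZMod (2 * n))), by rw [ha, hinv, QuaternionGroup.a_mul_a]⟩
      · rw [hxa]
        exact ⟨_, rfl⟩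
    ext z
    simp only [Set.mem_ofPred_eq, Set.mem_singleton_iff]
    constructor
    · rintro ⟨h, hh, rfl⟩
      rw [hh]
      rcases h with i | i
      · exact hcomm i j
      · exact absurd (hz.2 ⟨i, (hmem i).1 hh⟩) hs
    · rintro rfl
      exact ⟨1, by simp, by simp⟩
  · intro hs j _
    obtain ⟨i, hi⟩ := hz.1 hs
    ext z
    simp only [Set.mem_ofPred_eq, Set.mem_insert_iff, Set.mem_singleton_iff]
    constructor
    · rintro ⟨h, hh, rfl⟩
      rw [hh]
      rcases h with i | i
      · exact Or.inl (hcomm i j)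
      · exact Or.inr (hconj i j)
    · rintro (rfl | rfl)
      · exact ⟨1, by simp, by simp⟩
      · have hh := (hmem i).2 hi
        exact ⟨_, hh, by rw [hh, hconj]⟩
end

section
/- Let G = Dc_2 (the quaternion group of order 8) and let φ be any automorphism of G, with fixed-point group H and generalized symmetric space Q. Under φ-twisted conjugation g * q = g q φ(g)⁻¹, the group G acts transitively on Q, and every H-orbit in Q is a singleton. -/
/-- In the quaternion group every conjugate of `h` is `h` or `h⁻¹`. -/
lemma quaternion_conj (g h : QuaternionGroup 2) : g⁻¹ * h * g = h ∨ g⁻¹ * h * g = h⁻¹ := by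
  revert g h
  decide

/-- Let `G = Dc_2` (`QuaternionGroup 2`, the quaternion group of order 8) and let `φ` be any
automorphism of `G`, with fixed-point group `H = {h : φ h = h}` and generalized symmetric
space `Q = {g·φ(g)⁻¹ : g ∈ G}`. Under `φ`-twisted conjugation `g * q = g·q·φ(g)⁻¹`, `G` acts
transitively on `Q`, and every `H`-orbit in `Q` is a singleton. -/
theorem quaternion_orbits (φ : MulAut (QuaternionGroup 2)) :
    (∀ q ∈ {z : QuaternionGroup 2 | ∃ g, z = g * (φ g)⁻¹},
      {z : QuaternionGroup 2 | ∃ g : QuaternionGroup 2, z = g * q * (φ g)⁻¹} =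
        {z : QuaternionGroup 2 | ∃ g, z = g * (φ g)⁻¹}) ∧
    (∀ q ∈ {z : QuaternionGroup 2 | ∃ g, z = g * (φ g)⁻¹},
      {z : QuaternionGroup 2 | ∃ h, φ h = h ∧ z = h * q * (φ h)⁻¹} = {q}) := by
  constructor
  · rintro q ⟨k, rfl⟩
    ext z
    constructor
    · rintro ⟨g, rfl⟩
      exact ⟨g * k, by simp only [map_mul, mul_inv_rev, mul_assoc]⟩
    · rintro ⟨g, rfl⟩
      exact ⟨g * k⁻¹, by simp only [map_mul, map_inv]; group⟩
  · rintro q ⟨g, rfl⟩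
    have key : ∀ h, φ h = h → h * (g * (φ g)⁻¹) * (φ h)⁻¹ = g * (φ g)⁻¹ := by
      intro h hh
      have h1 : φ (g⁻¹ * h * g) = g⁻¹ * h * g := by
        rcases quaternion_conj g h with e | e <;> rw [e]
        · exact hh
        · rw [map_inv, hh]
      have h2 : (φ g)⁻¹ * h * φ g = g⁻¹ * h * g := by
        rw [← h1, map_mul, map_mul, map_inv, hh]
      have h3 : (φ g)⁻¹ * h = g⁻¹ * h * g * (φ g)⁻¹ := by
        rw [← h2]; group
      rw [hh, mul_inv_eq_iff_eq_mul, mul_assoc g, h3]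
      group
    ext z
    constructor
    · rintro ⟨h, hh, rfl⟩
      exact key h hh
    · rintro rfl
      exact ⟨1, map_one φ, by simp⟩
end
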